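/- Let p be an odd prime and let k be an integer with k > Σ_{r≥1} ⌊p/2^r⌋. Then every group of order 2^k · p contains a non-trivial normal elementary abelian 2-subgroup of order at most 2^p. -/

import Mathlib

theorem aux_card (H : Type*) [inst : Group H] [Finite H] (hc : ∀ a b : H, a * b = b * a)
    (h2 : ∀ a : H, a ^ 2 = 1) : Nat.card H ∣ 2 ^ Group.rank H := by
  let C : CommGroup H := { inst with mul_comm := hc }
  exact @card_dvd_exponent_pow_rank' H C _ 2 h2

/-- A finite group with a `2`-subgroup of index `p` whose normal core is non-trivial. -/
theorem aux_of_core {G : Type*} [Group G] [Finite G] (p : ℕ) (P : Subgroup G)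
    (hP : IsPGroup 2 P) (hidx : P.index = p) (hK : P.normalCore ≠ ⊥) :
    ∃ N : Subgroup G, N.Normal ∧ N ≠ ⊥ ∧ (∀ g ∈ N, g ^ 2 = 1) ∧
      Nat.card N ≤ 2 ^ p := by
  have : Fact (Nat.Prime 2) := ⟨Nat.prime_two⟩
  have hKP : P.normalCore ≤ P := P.normalCore_le
  have hK2 : IsPGroup 2 P.normalCore := hP.to_le hKP
  -- a non-trivial element of the core centralized by `P`
  obtain ⟨b, hbK, hb1, hbP⟩ : ∃ b ∈ P.normalCore, b ≠ 1 ∧ ∀ g ∈ P, g * b = b * g := by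
    let : MulAction P P.normalCore :=
      MulAction.compHom P.normalCore
        ((ConjAct.toConjAct (G := G)).toMonoidHom.comp P.subtype)
    have hsm : ∀ (g : P) (x : P.normalCore), ((g • x : P.normalCore) : G) = g * x * (g : G)⁻¹ :=
      fun g x => rfl
    have hdvd : 2 ∣ Nat.card P.normalCore := by
      rcases hK2.card_eq_or_dvd with h | h
      · exact absurd (Subgroup.card_eq_one.mp h) hK
      · exact h
    obtain ⟨b, hb, hne⟩ := hP.exists_fixed_point_of_prime_dvd_card_of_fixed_point
      P.normalCore hdvd (a := 1) (by
        intro g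
        apply Subtype.ext
        rw [hsm]; simp)
    refine ⟨b, b.2, fun h => hne (Subtype.ext h.symm), fun g hg => ?_⟩
    have := congrArg Subtype.val (hb ⟨g, hg⟩)
    rw [hsm] at this
    exact mul_inv_eq_iff_eq_mul.mp this
  -- an involution
  obtain ⟨v, hvK, hv1, hv2, hvP⟩ :
      ∃ v ∈ P.normalCore, v ≠ 1 ∧ v ^ 2 = 1 ∧ ∀ g ∈ P, g * v = v * g := by
    have h2 : 2 ∣ orderOf b := by
      have := hK2.dvd_orderOf (g := ⟨b, hbK⟩) (fun h => hb1 (congrArg Subtype.val h))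
      rwa [Subgroup.orderOf_mk] at this
    have hord : orderOf (b ^ (orderOf b / 2)) = 2 :=
      orderOf_pow_orderOf_div (orderOf_pos b).ne' h2
    refine ⟨b ^ (orderOf b / 2), pow_mem hbK _, ?_, ?_, ?_⟩
    · intro h
      rw [h, orderOf_one] at hord
      omega
    · exact orderOf_dvd_iff_pow_eq_one.mp hord.dvd
    · intro g hg
      exact (Commute.pow_right (hbP g hg) _)
  have hconj : ∀ x ∈ Group.conjugatesOfSet {v}, ∃ g : G, x = g * v * g⁻¹ := by
    intro x hx
    rw [Group.mem_conjugatesOfSet_iff] at hx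
    obtain ⟨a, ha, hax⟩ := hx
    rw [Set.mem_singleton_iff] at ha
    subst ha
    obtain ⟨c, hc⟩ := isConj_iff.mp hax
    exact ⟨c, hc.symm⟩
  have hcomm : ∀ x ∈ Group.conjugatesOfSet {v}, ∀ y ∈ Group.conjugatesOfSet {v},
      x * y = y * x := by
    intro x hx y hy
    obtain ⟨g, rfl⟩ := hconj x hx
    have hy' : y ∈ P.normalCore :=
      Group.conjugatesOfSet_subset (by simpa using hvK) hy
    have h1 : g⁻¹ * y * g ∈ P := hKP (by
      simpa using (inferInstance : P.normalCore.Normal).conj_mem y hy' g⁻¹)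
    have h2 := hvP _ h1
    calc g * v * g⁻¹ * y = g * (v * (g⁻¹ * y * g)) * g⁻¹ := by group
      _ = g * ((g⁻¹ * y * g) * v) * g⁻¹ := by rw [h2]
      _ = y * (g * v * g⁻¹) := by group
  have hmc : IsMulCommutative (Subgroup.normalClosure {v}) :=
    Subgroup.isMulCommutative_closure hcomm
  have hsq : ∀ g ∈ Subgroup.normalClosure {v}, g ^ 2 = 1 := by
    intro g hg
    refine Subgroup.closure_induction (p := fun g _ => g ^ 2 = 1) ?_ (one_pow 2) ?_ ?_ hg
    · intro x hx
      obtain ⟨g, rfl⟩ := hconj x hx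
      rw [conj_pow, hv2]; simp
    · intro x y hx hy h1 h2
      have hc : Commute x y :=
        congrArg Subtype.val (hmc.is_comm.comm (⟨x, hx⟩ : Subgroup.normalClosure {v}) ⟨y, hy⟩)
      rw [hc.mul_pow, h1, h2, one_mul]
    · intro x hx h1
      rw [inv_pow, h1, inv_one]
  refine ⟨Subgroup.normalClosure {v}, inferInstance, ?_, hsq, ?_⟩
  · rw [Ne, Subgroup.normalClosure_eq_bot_iff]
    simpa using hv1
  · have hc : Nat.card (Group.conjugatesOfSet {v}) ≤ p := by
      have hsub : Group.conjugatesOfSet {v} ⊆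
          Set.range (fun q : G ⧸ P => q.out * v * q.out⁻¹) := by
        intro x hx
        obtain ⟨g, rfl⟩ := hconj x hx
        obtain ⟨h, hh⟩ := QuotientGroup.mk_out_eq_mul P g
        refine ⟨(g : G ⧸ P), ?_⟩
        simp only [hh]
        have := hvP h h.2
        calc g * h * v * (g * h)⁻¹ = g * ((h : G) * v) * (h : G)⁻¹ * g⁻¹ := by group
          _ = g * (v * h) * (h : G)⁻¹ * g⁻¹ := by rw [this]
          _ = g * v * g⁻¹ := by group
      calc Nat.card (Group.conjugatesOfSet {v}) ≤ _ := Nat.card_mono (Set.toFinite _) hsub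
        _ ≤ Nat.card (G ⧸ P) := Finite.card_range_le _
        _ = p := hidx
    have hr : Group.rank (Subgroup.normalClosure {v}) ≤ p :=
      (Subgroup.rank_closure_finite_le_nat_card (Group.conjugatesOfSet {v})).trans hc
    have hd : Nat.card (Subgroup.normalClosure {v}) ∣
        2 ^ Group.rank (Subgroup.normalClosure {v}) :=
      aux_card _ (fun a b => hmc.is_comm.comm a b)
        (fun g => Subtype.ext (hsq g g.2))
    exact (Nat.le_of_dvd (by positivity) hd).trans (Nat.pow_le_pow_right (by norm_num) hr)

theorem normal_elementary_abelian_two_subgroup (p k : ℕ) (hp : p.Prime)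
    (hodd : Odd p) (hk : (∑ r ∈ Finset.Icc 1 p, p / 2 ^ r) < k)
    (G : Type*) [Group G] [Finite G] (hG : Nat.card G = 2 ^ k * p) :
    ∃ N : Subgroup G, N.Normal ∧ N ≠ ⊥ ∧ (∀ g ∈ N, g ^ 2 = 1) ∧
      Nat.card N ≤ 2 ^ p := by
  have : Fact (Nat.Prime 2) := ⟨Nat.prime_two⟩
  obtain ⟨P, hPc⟩ := Sylow.exists_subgroup_card_pow_prime (G := G) 2 (n := k)
    (hG ▸ dvd_mul_right _ _)
  have hidx : P.index = p := by
    have := P.card_mul_index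
    rw [hPc, hG] at this
    exact Nat.eq_of_mul_eq_mul_left (by positivity) this
  refine aux_of_core p P (IsPGroup.of_card hPc) hidx fun hbot => ?_
  have hdvd : P.normalCore.index ∣ p.factorial := by
    rw [Subgroup.normalCore_eq_ker, Subgroup.index_ker, ← hidx, Subgroup.index_eq_card,
      ← Nat.card_perm]
    exact Subgroup.card_subgroup_dvd_card _
  rw [hbot, Subgroup.index_bot, hG] at hdvd
  have h2 : 2 ^ k ∣ p.factorial := (dvd_mul_right _ _).trans hdvd
  rw [padicValNat_dvd_iff_le (Nat.factorial_ne_zero p),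
    padicValNat_factorial (b := p + 1) (Nat.lt_succ_of_le (Nat.log_le_self 2 p))] at h2
  have : Finset.Ico 1 (p + 1) = Finset.Icc 1 p := by ext; simp
  rw [this] at h2
  omega
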